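/- Let W be a finite Coxeter group with longest element w₀, let s ∈ S, and let J = S \ {s}. Then the right descent set of the minimal-length coset representative ᴶw₀ is exactly {w₀ s w₀}. -/

import Mathlib

namespace CoxPop

variable {B W : Type*} [Group W] {M : CoxeterMatrix B} (cs : CoxeterSystem M W)

/-- The standard parabolic subgroup generated by the simple reflections indexed by `J`. -/
def parabolic (J : Set B) : Subgroup W :=
  Subgroup.closure (cs.simple '' J)

/-- The right descent set of `w`. -/
def D (w : W) : Set B := {i | cs.IsRightDescent w i}

/-- `u` is a longest element of the standard parabolic subgroup `W_J`. -/
def IsLongestIn (J : Set B) (u : W) : Prop :=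
  u ∈ parabolic cs J ∧ ∀ v ∈ parabolic cs J, cs.length v ≤ cs.length u

open Classical in
/-- The longest element `w₀(J)` of the standard parabolic subgroup `W_J`. -/
noncomputable def w0 (J : Set B) : W :=
  if h : ∃ u, IsLongestIn cs J u then h.choose else 1

/-- The Coxeter pop-stack-sorting operator: `Pop w = w * w₀(D_R(w))`. -/
noncomputable def Pop (w : W) : W := w * w0 cs (D cs w)

/-- The right weak order on `W`: `x ≤_R y` iff `ℓ(x) + ℓ(x⁻¹y) = ℓ(y)`. -/
def rweakLE (x y : W) : Prop := cs.length x + cs.length (x⁻¹ * y) = cs.length y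

/-- `u` is the minimal-length representative `ᴶw` of the right coset `W_J w`. -/
def IsMinRep (J : Set B) (w u : W) : Prop :=
  (∃ p ∈ parabolic cs J, u = p * w) ∧
    ∀ v : W, (∃ p ∈ parabolic cs J, v = p * w) → cs.length u ≤ cs.length v

/-- A map `f : W → W` is compulsive if `f(w) ≤_R w` and `f(w) ≤_R ws` for every
right descent `s` of `w`. -/
def Compulsive (f : W → W) : Prop :=
  ∀ w : W, rweakLE cs (f w) w ∧ ∀ i ∈ D cs w, rweakLE cs (f w) (w * cs.simple i)

/-- The strong Bruhat order: `x ≤ y` iff some reduced word for `y` contains a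
reduced word for `x` as a (not necessarily contiguous) subword. -/
def bruhatLE (x y : W) : Prop :=
  ∃ ω : List B, cs.wordProd ω = y ∧ ω.length = cs.length y ∧
    ∃ ω' : List B, ω'.Sublist ω ∧ cs.wordProd ω' = x ∧ ω'.length = cs.length x

/-- The Coxeter system is irreducible: its Coxeter diagram is connected, i.e. the
index set admits no nontrivial partition into two mutually commuting parts. -/
def Irreducible : Prop :=
  ∀ J : Set B, (∀ i ∈ J, ∀ j ∈ Jᶜ, M i j = 2) → J = ∅ ∨ J = Set.univ

section GeometricRepresentation

/-- The simple coroot of index `i`: the linear form on the span of the simple roots whose value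
on the simple root of index `j` is `-2 cos (π / M i j)`, read as `-2` when `M i j = 0`. -/
noncomputable def simpleCoroot (M : CoxeterMatrix B) (i : B) : (B →₀ ℝ) →ₗ[ℝ] ℝ :=
  Finsupp.linearCombination ℝ fun j => -2 * Real.cos (Real.pi / M i j)

theorem simpleCoroot_single (M : CoxeterMatrix B) (i j : B) :
    simpleCoroot M i (Finsupp.single j 1) = -2 * Real.cos (Real.pi / M i j) := by
  simp [simpleCoroot]

theorem simpleCoroot_single_self (M : CoxeterMatrix B) (i : B) :
    simpleCoroot M i (Finsupp.single i 1) = 2 := by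
  simp [simpleCoroot_single]

/-- The reflection in the simple root of index `i`. -/
noncomputable def simpleReflection (M : CoxeterMatrix B) (i : B) : (B →₀ ℝ) ≃ₗ[ℝ] (B →₀ ℝ) :=
  Module.reflection (simpleCoroot_single_self M i)

/-- Two reflections at angle `π / m` satisfy the dihedral relation of order `m`. -/
theorem reflection_mul_reflection_pow_eq_one {V : Type*} [AddCommGroup V] [Module ℝ V]
    {x y : V} {f g : V →ₗ[ℝ] ℝ} (hf : f x = 2) (hg : g y = 2) {m : ℕ} (hm : 2 ≤ m)
    (hfy : f y = -2 * Real.cos (Real.pi / m)) (hgx : g x = -2 * Real.cos (Real.pi / m)) :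
    (Module.reflection hf * Module.reflection hg) ^ m = 1 := by
  ext z
  rcases hm.eq_or_lt with rfl | hm
  · have hfy' : f y = 0 := by simp [hfy]
    have hgx' : g x = 0 := by simp [hgx]
    simp [pow_two, Module.reflection_apply, hf, hg, hfy', hgx']
    module
  set θ : ℝ := 2 * (Real.pi / m) with hθ
  have hm0 : (m : ℝ) ≠ 0 := by positivity
  have hmθ : m * θ = 2 * Real.pi := by rw [hθ]; field_simp
  have hsin : Real.sin θ ≠ 0 := by
    have h3 : (3 : ℝ) ≤ m := by exact_mod_cast hm
    refine (Real.sin_pos_of_pos_of_lt_pi (by positivity) ?_).ne'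
    by_contra! h
    nlinarith [Real.pi_pos]
  have ht : 2 * Real.cos θ = f y * g x - 2 := by
    rw [hfy, hgx, hθ, Real.cos_two_mul]; ring
  rw [Module.reflection_mul_reflection_pow_apply hf hg m z (2 * Real.cos θ) ht]
  have hS (n : ℤ) := Polynomial.Chebyshev.S_two_mul_real_cos θ n
  rcases Nat.even_or_odd' m with ⟨k, rfl | rfl⟩
  · have h0 : (Polynomial.Chebyshev.S ℝ (k - 1)).eval (2 * Real.cos θ) = 0 := by
      refine (mul_eq_zero.mp ((hS _).trans ?_)).resolve_right hsin
      push_cast at hmθ ⊢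
      rw [show ((k : ℝ) - 1 + 1) * θ = Real.pi by linarith, Real.sin_pi]
    have e₁ : (((2 * k : ℕ) : ℤ) - 2) / 2 = k - 1 := by lia
    have e₂ : (((2 * k : ℕ) : ℤ) - 1) / 2 = k - 1 := by lia
    simp only [e₁, e₂, h0, zero_mul, zero_smul, add_zero, LinearEquiv.coe_one, id]
  · have h0 : (Polynomial.Chebyshev.S ℝ k).eval (2 * Real.cos θ) +
        (Polynomial.Chebyshev.S ℝ (k - 1)).eval (2 * Real.cos θ) = 0 := by
      refine (mul_eq_zero.mp ?_).resolve_right hsin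
      rw [add_mul, hS, hS]
      push_cast at hmθ ⊢
      rw [show ((k : ℝ) + 1) * θ = 2 * Real.pi - k * θ by linarith, Real.sin_two_pi_sub]
      ring_nf
    have e₁ : (((2 * k + 1 : ℕ) : ℤ) - 2) / 2 = k - 1 := by lia
    have e₂ : (((2 * k + 1 : ℕ) : ℤ) - 1) / 2 = k := by lia
    have e₃ : (((2 * k + 1 : ℕ) : ℤ) - 3) / 2 = k - 1 := by lia
    have e₄ : ((2 * k + 1 : ℕ) : ℤ) / 2 = k := by lia
    simp only [e₁, e₂, e₃, e₄, h0, mul_zero, zero_smul, add_zero, LinearEquiv.coe_one, id]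

theorem isLiftable_simpleReflection (M : CoxeterMatrix B) :
    M.IsLiftable (simpleReflection M) := by
  intro i j
  by_cases hij : i = j
  · subst hij
    ext1 z
    simp [simpleReflection, Module.involutive_reflection _ z]
  by_cases h0 : M i j = 0
  · simp [h0]
  have h1 : M i j ≠ 1 := M.off_diagonal i j hij
  refine reflection_mul_reflection_pow_eq_one _ _ (by lia) (simpleCoroot_single M i j) ?_
  rw [simpleCoroot_single, M.symmetric j i]

/-- The geometric representation of a Coxeter group on the span of the simple roots. -/
noncomputable def geometricRep : W →* ((B →₀ ℝ) ≃ₗ[ℝ] (B →₀ ℝ)) :=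
  cs.lift ⟨simpleReflection M, isLiftable_simpleReflection M⟩

theorem geometricRep_simple (i : B) : geometricRep cs (cs.simple i) = simpleReflection M i :=
  cs.lift_apply_simple _ i

theorem geometricRep_apply_of_mem_parabolic {J : Set B} {w : W} (hw : w ∈ parabolic cs J)
    {s : B} (hs : s ∉ J) (v : B →₀ ℝ) : geometricRep cs w v s = v s := by
  induction hw using Subgroup.closure_induction generalizing v with
  | mem x hx =>
    obtain ⟨j, hj, rfl⟩ := hx
    have hjs : j ≠ s := fun h => hs (h ▸ hj)
    simp [geometricRep_simple, simpleReflection, Module.reflection_apply, hjs]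
  | one => simp
  | mul x y _ _ hx hy => simp [hx, hy]
  | inv x _ hx =>
    rw [← hx ((geometricRep cs x⁻¹) v), ← LinearEquiv.mul_apply, ← map_mul]
    simp

theorem simple_notMem_parabolic {J : Set B} {s : B} (hs : s ∉ J) :
    cs.simple s ∉ parabolic cs J := by
  intro h
  have := geometricRep_apply_of_mem_parabolic cs h hs (Finsupp.single s 1)
  simp [geometricRep_simple, simpleReflection] at this
  norm_num at this

theorem simple_injective : Function.Injective cs.simple := by
  intro i j hij
  by_contra hne
  refine simple_notMem_parabolic cs (J := {j}) (s := i) (by simpa using hne) ?_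
  rw [hij]
  exact Subgroup.subset_closure ⟨j, rfl, rfl⟩

end GeometricRepresentation

section InversionParity

open Classical in
/-- The action of a simple reflection on `W × ℤ/2`, conjugating the first coordinate and changing
the second one exactly at that reflection. -/
noncomputable def signedConj (i : B) : Function.End (W × ZMod 2) :=
  fun x => (cs.simple i * x.1 * cs.simple i, x.2 + if x.1 = cs.simple i then 1 else 0)

theorem simple_mul_pow_simple_mul_simple (i j : B) (k : ℕ) :
    cs.simple j * (cs.simple i * cs.simple j) ^ k =
      ((cs.simple i * cs.simple j) ^ k)⁻¹ * cs.simple j := by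
  have h : SemiconjBy (cs.simple j) (cs.simple i * cs.simple j) (cs.simple i * cs.simple j)⁻¹ := by
    simp [SemiconjBy, mul_assoc]
  rw [← inv_pow]
  exact h.pow_right k

open Classical in
theorem signedConj_mul_pow_apply (i j : B) (k : ℕ) (t : W) (e : ZMod 2) :
    ((signedConj cs i * signedConj cs j) ^ k) (t, e) =
      ((cs.simple i * cs.simple j) ^ k * t * ((cs.simple i * cs.simple j) ^ k)⁻¹,
        e + ∑ r ∈ Finset.range (2 * k),
          if t = cs.simple j * (cs.simple i * cs.simple j) ^ r then 1 else 0) := by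
  induction k with
  | zero => simp; rfl
  | succ k ih =>
    have hstep : ((signedConj cs i * signedConj cs j) ^ (k + 1)) (t, e) =
        signedConj cs i (signedConj cs j (((signedConj cs i * signedConj cs j) ^ k) (t, e))) := by
      rw [pow_succ']; rfl
    rw [hstep, ih]
    set c := cs.simple i * cs.simple j with hc
    have hcomm := simple_mul_pow_simple_mul_simple cs i j k
    rw [← hc] at hcomm
    have h₁ : c ^ k * t * (c ^ k)⁻¹ = cs.simple j ↔ t = cs.simple j * c ^ (2 * k) := by
      rw [two_mul, pow_add, ← mul_assoc, hcomm, mul_inv_eq_iff_eq_mul, mul_assoc,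
        eq_inv_mul_iff_mul_eq]
    have h₂ : cs.simple j * (c ^ k * t * (c ^ k)⁻¹) * cs.simple j = cs.simple i ↔
        t = cs.simple j * c ^ (2 * k + 1) := by
      have hjc : cs.simple j * c ^ (2 * k + 1) =
          (c ^ k)⁻¹ * (cs.simple j * cs.simple i * cs.simple j) * c ^ k := by
        rw [show 2 * k + 1 = k + (1 + k) by ring, pow_add, ← mul_assoc, hcomm, pow_add, pow_one, hc]
        simp only [mul_assoc]
      rw [hjc]
      constructor
      · intro h
        rw [← h]
        simp [mul_assoc]
      · rintro rfl
        simp [mul_assoc]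
    simp only [signedConj, h₁, h₂]
    refine Prod.ext ?_ ?_
    · simp [pow_succ', hc, mul_assoc]
    · simp only [show 2 * (k + 1) = 2 * k + 1 + 1 by ring, Finset.sum_range_succ]
      ring

theorem isLiftable_signedConj : M.IsLiftable (signedConj cs) := by
  classical
  intro i j
  funext ⟨t, e⟩
  rw [signedConj_mul_pow_apply, two_mul, Finset.sum_range_add]
  simp only [pow_add, cs.simple_mul_simple_pow i j, one_mul, inv_one, mul_one,
    CharTwo.add_self_eq_zero, add_zero]
  rfl

/-- The action of `W` on `W × ℤ/2` extending `signedConj`. -/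
noncomputable def signedConjHom : W →* Function.End (W × ZMod 2) :=
  cs.lift ⟨signedConj cs, isLiftable_signedConj cs⟩

theorem signedConjHom_simple (i : B) : signedConjHom cs (cs.simple i) = signedConj cs i :=
  cs.lift_apply_simple _ i

theorem signedConjHom_mul_apply (v w : W) (x : W × ZMod 2) :
    signedConjHom cs (v * w) x = signedConjHom cs v (signedConjHom cs w x) := by
  rw [map_mul]; rfl

open Classical in
theorem signedConjHom_wordProd_apply (ω : List B) (t : W) (e : ZMod 2) :
    signedConjHom cs (cs.wordProd ω) (t, e) =
      (cs.wordProd ω * t * (cs.wordProd ω)⁻¹, e + ((cs.rightInvSeq ω).count t : ℕ)) := by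
  induction ω with
  | nil => simp; rfl
  | cons i ω ih =>
    have h : cs.wordProd ω * t * (cs.wordProd ω)⁻¹ = cs.simple i ↔
        (cs.wordProd ω)⁻¹ * cs.simple i * cs.wordProd ω = t := by
      rw [mul_inv_eq_iff_eq_mul, mul_assoc, inv_mul_eq_iff_eq_mul, eq_comm]
    rw [cs.wordProd_cons, signedConjHom_mul_apply, ih, signedConjHom_simple]
    simp only [signedConj, h]
    simp [CoxeterSystem.rightInvSeq, List.count_cons, mul_assoc, add_assoc]

/-- The parity of the number of occurrences of `t` in the right inversion sequence of any word
for `w`. -/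
noncomputable def inversionParity (w t : W) : ZMod 2 := (signedConjHom cs w (t, 0)).2

open Classical in
theorem inversionParity_wordProd (ω : List B) (t : W) :
    inversionParity cs (cs.wordProd ω) t = ((cs.rightInvSeq ω).count t : ℕ) := by
  simp [inversionParity, signedConjHom_wordProd_apply]

theorem signedConjHom_apply (w t : W) (e : ZMod 2) :
    signedConjHom cs w (t, e) = (w * t * w⁻¹, e + inversionParity cs w t) := by
  classical
  obtain ⟨ω, -, rfl⟩ := cs.exists_isReduced w
  rw [signedConjHom_wordProd_apply, inversionParity_wordProd]

theorem inversionParity_mul (v w t : W) :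
    inversionParity cs (v * w) t =
      inversionParity cs w t + inversionParity cs v (w * t * w⁻¹) := by
  conv_lhs => rw [inversionParity, signedConjHom_mul_apply, signedConjHom_apply,
    signedConjHom_apply]
  simp

theorem inversionParity_one (t : W) : inversionParity cs 1 t = 0 := by
  classical
  simpa using inversionParity_wordProd cs [] t

theorem inversionParity_simple_self (i : B) :
    inversionParity cs (cs.simple i) (cs.simple i) = 1 := by
  classical
  simpa using inversionParity_wordProd cs [i] (cs.simple i)

theorem inversionParity_self {t : W} (ht : cs.IsReflection t) : inversionParity cs t t = 1 := by
  obtain ⟨w, i, rfl⟩ := ht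
  have h := inversionParity_mul cs w w⁻¹ (w * cs.simple i * w⁻¹)
  have hconj : w⁻¹ * (w * cs.simple i * w⁻¹) * w⁻¹⁻¹ = cs.simple i := by group
  rw [mul_inv_cancel, inversionParity_one, hconj] at h
  rw [inversionParity_mul, inversionParity_mul, hconj, inversionParity_simple_self,
    cs.inv_simple, cs.simple_mul_simple_self, one_mul]
  linear_combination -h

theorem mem_rightInvSeq_of_inversionParity_ne_zero {ω : List B} {t : W}
    (h : inversionParity cs (cs.wordProd ω) t ≠ 0) : t ∈ cs.rightInvSeq ω := by
  classical
  by_contra hmem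
  rw [inversionParity_wordProd, List.count_eq_zero_of_not_mem hmem] at h
  exact h Nat.cast_zero

theorem length_mul_lt_of_inversionParity_ne_zero {w t : W} (h : inversionParity cs w t ≠ 0) :
    cs.length (w * t) < cs.length w := by
  obtain ⟨ω, hω, rfl⟩ := cs.exists_isReduced w
  exact (cs.isRightInversion_of_mem_rightInvSeq hω
    (mem_rightInvSeq_of_inversionParity_ne_zero cs h)).2

theorem inversionParity_ne_zero_iff {w t : W} (ht : cs.IsReflection t) :
    inversionParity cs w t ≠ 0 ↔ cs.length (w * t) < cs.length w := by
  refine ⟨length_mul_lt_of_inversionParity_ne_zero cs, fun hlt h0 => ?_⟩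
  have h : inversionParity cs (w * t) t ≠ 0 := by
    rw [inversionParity_mul, inversionParity_self cs ht, mul_inv_cancel_right, h0]
    decide
  have hlt' := length_mul_lt_of_inversionParity_ne_zero cs h
  rw [mul_assoc, ht.mul_self, mul_one] at hlt'
  exact hlt.asymm hlt'

end InversionParity

section Parabolic

theorem exists_word_of_mem_parabolic {J : Set B} {w : W} (hw : w ∈ parabolic cs J) :
    ∃ ω : List B, (∀ j ∈ ω, j ∈ J) ∧ cs.wordProd ω = w := by
  induction hw using Subgroup.closure_induction with
  | mem x hx =>
    obtain ⟨j, hj, rfl⟩ := hx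
    exact ⟨[j], by simpa using hj, by simp⟩
  | one => exact ⟨[], by simp, by simp⟩
  | mul x y _ _ hx hy =>
    obtain ⟨ω, hω, rfl⟩ := hx
    obtain ⟨ω', hω', rfl⟩ := hy
    refine ⟨ω ++ ω', fun j hj => ?_, cs.wordProd_append ω ω'⟩
    exact (List.mem_append.mp hj).elim (hω j) (hω' j)
  | inv x _ hx =>
    obtain ⟨ω, hω, rfl⟩ := hx
    exact ⟨ω.reverse, fun j hj => hω j (List.mem_reverse.mp hj), cs.wordProd_reverse ω⟩

theorem wordProd_mem_parabolic {J : Set B} {ω : List B} (hω : ∀ j ∈ ω, j ∈ J) :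
    cs.wordProd ω ∈ parabolic cs J := by
  refine Subgroup.list_prod_mem _ fun x hx => ?_
  obtain ⟨j, hj, rfl⟩ := List.mem_map.mp hx
  exact Subgroup.subset_closure ⟨j, hω j hj, rfl⟩

theorem mem_parabolic_of_mem_rightInvSeq {J : Set B} {ω : List B} (hω : ∀ j ∈ ω, j ∈ J) {t : W}
    (ht : t ∈ cs.rightInvSeq ω) : t ∈ parabolic cs J := by
  induction ω with
  | nil => simp at ht
  | cons i ω ih =>
    have hω' : ∀ j ∈ ω, j ∈ J := fun j hj => hω j (List.mem_cons_of_mem i hj)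
    have hp := wordProd_mem_parabolic cs hω'
    rcases List.mem_cons.mp ht with rfl | ht
    · exact mul_mem (mul_mem (inv_mem hp)
        (Subgroup.subset_closure ⟨i, hω i List.mem_cons_self, rfl⟩)) hp
    · exact ih hω' ht

theorem not_isRightDescent_of_mem_parabolic {J : Set B} {w : W} (hw : w ∈ parabolic cs J)
    {s : B} (hs : s ∉ J) : ¬ cs.IsRightDescent w s := by
  intro h
  obtain ⟨ω, hω, rfl⟩ := exists_word_of_mem_parabolic cs hw
  exact simple_notMem_parabolic cs hs <| mem_parabolic_of_mem_rightInvSeq cs hω <|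
    mem_rightInvSeq_of_inversionParity_ne_zero cs <|
      (inversionParity_ne_zero_iff cs (cs.isReflection_simple s)).mpr h

end Parabolic

section LongestElement

theorem isLongestIn_w0 [Finite W] (J : Set B) : IsLongestIn cs J (w0 cs J) := by
  have h : ∃ u, IsLongestIn cs J u := by
    obtain ⟨u, hu, hmax⟩ := Set.exists_max_image (parabolic cs J : Set W) cs.length
      (Set.toFinite _) ⟨1, one_mem _⟩
    exact ⟨u, hu, hmax⟩
  rw [w0, dif_pos h]
  exact h.choose_spec

theorem parabolic_univ : parabolic cs Set.univ = ⊤ := by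
  rw [parabolic, Set.image_univ, cs.subgroup_closure_range_simple]

theorem length_mul_add_length_of_forall_length_le {w : W}
    (hw : ∀ v, cs.length v ≤ cs.length w) (v : W) :
    cs.length (w * v) + cs.length v = cs.length w := by
  obtain ⟨ω, hω, rfl⟩ := cs.exists_isReduced v
  induction ω using List.reverseRecOn with
  | nil => simp
  | append_singleton ω i ih =>
    have hω' : cs.IsReduced ω := by simpa using hω.take ω.length
    specialize ih hω'
    have hlen : cs.length (cs.wordProd ω * cs.simple i) = cs.length (cs.wordProd ω) + 1 := by
      have h := hω.eq
      rw [cs.wordProd_append, cs.wordProd_singleton, List.length_append, List.length_singleton] at h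
      rw [h, hω'.eq]
    have hrefl := cs.isReflection_simple i
    have h0 : inversionParity cs (cs.wordProd ω) (cs.simple i) = 0 := by
      by_contra h
      have := (inversionParity_ne_zero_iff cs hrefl).mp h
      lia
    have hdesc : cs.IsRightDescent (w * cs.wordProd ω) i := by
      refine (inversionParity_ne_zero_iff cs hrefl).mp ?_
      rw [inversionParity_mul, h0, zero_add, inversionParity_ne_zero_iff cs (hrefl.conj _)]
      exact (hw _).lt_of_ne ((hrefl.conj _).length_mul_left_ne w)
    rw [cs.isRightDescent_iff] at hdesc
    rw [cs.wordProd_append, cs.wordProd_singleton, ← mul_assoc]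
    lia

end LongestElement

/-- for `W` finite with longest element `w₀` and `J = S \\ {s}`, the right
descent set of the minimal-length coset representative `ᴶw₀` is exactly `{w₀ s w₀}`. -/
theorem rightDescents_minRep_w0 [Finite W] (s : B) (m : W)
    (hm : IsMinRep cs (Set.univ \ {s}) (w0 cs Set.univ) m) :
    D cs m = {i : B | cs.simple i =
      w0 cs Set.univ * cs.simple s * w0 cs Set.univ} := by
  set w := w0 cs Set.univ
  have hmax (v : W) : cs.length v ≤ cs.length w :=
    (isLongestIn_w0 cs Set.univ).2 v (parabolic_univ cs ▸ Subgroup.mem_top v)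
  have hleft := length_mul_add_length_of_forall_length_le cs hmax
  have hsq : w * w = 1 := cs.length_eq_zero_iff.mp (by have := hleft w; lia)
  have hinv : w⁻¹ = w := inv_eq_of_mul_eq_one_left hsq
  have hright (v : W) : cs.length (v * w) + cs.length v = cs.length w := by
    rw [← hleft v⁻¹, cs.length_inv, ← cs.length_inv (v * w), mul_inv_rev, hinv]
  obtain ⟨⟨p, hp, rfl⟩, hmin⟩ := hm
  have hpmax (v : W) (hv : v ∈ parabolic cs (Set.univ \ {s})) : cs.length v ≤ cs.length p := by
    have := hmin _ ⟨v, hv, rfl⟩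
    have := hright v
    have := hright p
    lia
  ext i
  obtain ⟨j, hj⟩ : ∃ j, w * cs.simple i * w = cs.simple j := by
    rw [← cs.length_eq_one_iff]
    have := hright (w * cs.simple i)
    have := hleft (cs.simple i)
    have := cs.length_simple i
    lia
  have hi : cs.simple i = w * cs.simple s * w ↔ j = s := by
    rw [← (simple_injective cs).eq_iff, ← hj]
    constructor
    · intro h
      simp [h, mul_assoc, hsq, ← mul_assoc w w]
    · intro h
      simp [← h, mul_assoc, hsq, ← mul_assoc w w]
  have hdesc : cs.IsRightDescent (p * w) i ↔ ¬ cs.IsRightDescent p j := by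
    have hmul : p * w * cs.simple i = p * cs.simple j * w := by
      simp [← hj, mul_assoc, hsq]
    rw [cs.not_isRightDescent_iff, cs.isRightDescent_iff, hmul]
    have := hright p
    have := hright (p * cs.simple j)
    lia
  simp only [D, Set.mem_ofPred_eq, hi, hdesc]
  refine ⟨fun h => ?_, ?_⟩
  · by_contra hjs
    have := hpmax _ (mul_mem hp (Subgroup.subset_closure ⟨j, ⟨trivial, hjs⟩, rfl⟩))
    rw [cs.not_isRightDescent_iff] at h
    lia
  · rintro rfl
    exact not_isRightDescent_of_mem_parabolic cs hp (by simp)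

end CoxPop
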